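/- arXiv:2005.13794 — 3 statements merged into one kernel-verified Lean document; each statement's English description precedes it below -/
import Mathlib

section
/- As h → 0⁺, the second moment of one summand of the boundary-free kernel distribution estimator satisfies E[W²((g⁻¹(x) − g⁻¹(X))/h)] = F_X(x) − 2h·g'(g⁻¹(x))·f_X(x)·r₁ + o(h) for each fixed x ∈ Ω, where r₁ = ∫_ℝ v·K(v)·W(v)dv. -/
open MeasureTheory ProbabilityTheory Filter Topology Asymptotics Set

/-- A bounded function that is differentiable at `a` satisfies a global Lipschitz estimate
at `a`. -/
lemma HasDerivAt.exists_global_bound {G : ℝ → ℝ} {a G' M : ℝ} (hG : HasDerivAt G G' a)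
    (hM : ∀ u, |G u - G a| ≤ M) : ∃ C, ∀ u, |G u - G a| ≤ C * |u - a| := by
  obtain ⟨c, hc⟩ := hG.isBigO_sub.bound
  obtain ⟨δ, hδ, hball⟩ := Metric.eventually_nhds_iff.1 hc
  have hM0 : 0 ≤ M := (abs_nonneg _).trans (hM a)
  refine ⟨max c (M / δ), fun u => ?_⟩
  rcases lt_or_ge |u - a| δ with h | h
  · exact (hball (y := u) (by simpa [Real.dist_eq] using h)).trans
      (mul_le_mul_of_nonneg_right (le_max_left _ _) (abs_nonneg _))
  · calc |G u - G a| ≤ M := hM u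
      _ = M / δ * δ := by field_simp
      _ ≤ M / δ * |u - a| := by gcongr
      _ ≤ _ := mul_le_mul_of_nonneg_right (le_max_right _ _) (abs_nonneg _)

/-- First-order expansion of a smoothed bounded function at a point of differentiability. -/
lemma tendsto_integral_mul_slope {G k : ℝ → ℝ} {a G' M : ℝ} (hG : HasDerivAt G G' a)
    (hGc : Continuous G) (hM : ∀ u, |G u - G a| ≤ M) (hk : Continuous k)
    (hvk : Integrable fun v => v * k v) :
    Tendsto (fun h : ℝ => ∫ v, k v * ((G (a - h * v) - G a) / h)) (𝓝[>] 0)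
      (𝓝 (∫ v, k v * (-v * G'))) := by
  obtain ⟨C, hC⟩ := hG.exists_global_bound hM
  refine tendsto_integral_filter_of_dominated_convergence (fun v => C * |v * k v|) ?_ ?_
    (hvk.abs.const_mul C) ?_
  · exact Eventually.of_forall fun h => Continuous.aestronglyMeasurable (by fun_prop)
  · filter_upwards [self_mem_nhdsWithin] with h (hh : 0 < h)
    refine Eventually.of_forall fun v => ?_
    have := hC (a - h * v)
    rw [show a - h * v - a = -(h * v) by ring, abs_neg, abs_mul, abs_of_pos hh] at this
    rw [Real.norm_eq_abs, abs_mul, abs_div, abs_of_pos hh, abs_mul]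
    calc |k v| * (|G (a - h * v) - G a| / h) ≤ |k v| * (C * (h * |v|) / h) := by gcongr
      _ = C * (|v| * |k v|) := by field_simp
  · refine Eventually.of_forall fun v => Tendsto.const_mul _ ?_
    have hd : HasDerivAt (fun h : ℝ => G (a - h * v)) (G' * (-v)) 0 := by
      refine HasDerivAt.comp (h₂ := G) 0 (by simpa using hG) ?_
      simpa using ((hasDerivAt_id (0 : ℝ)).mul_const v).const_sub a
    have ht := (hasDerivAt_iff_tendsto_slope_zero.1 hd).mono_left
      (nhdsWithin_mono 0 fun h (hh : 0 < h) => hh.ne')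
    rw [mul_comm G'] at ht
    refine ht.congr fun h => ?_
    simp [div_eq_inv_mul]

/-- The distribution function of a continuous integrable density has that density as
derivative. -/
lemma hasDerivAt_integral_Iic {K : ℝ → ℝ} (hc : Continuous K) (hi : Integrable K) (v : ℝ) :
    HasDerivAt (fun v => ∫ w in Iic v, K w) (K v) v := by
  have h := (intervalIntegral.integral_hasDerivAt_right (hc.intervalIntegrable 0 v)
    (hc.stronglyMeasurableAtFilter _ _) hc.continuousAt).const_add (∫ w in Iic 0, K w)
  refine h.congr_of_eventuallyEq (Eventually.of_forall fun u => ?_)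
  have := intervalIntegral.integral_Iic_sub_Iic (hi.integrableOn (s := Iic 0))
    (hi.integrableOn (s := Iic u))
  simp only [← this]
  ring

lemma tendsto_integral_Iic_atTop {K : ℝ → ℝ} (hi : Integrable K) :
    Tendsto (fun v => ∫ w in Iic v, K w) atTop (𝓝 (∫ w, K w)) :=
  (aecover_Iic tendsto_id).integral_tendsto_of_countably_generated hi

lemma tendsto_integral_Iic_atBot {K : ℝ → ℝ} (hi : Integrable K) :
    Tendsto (fun v => ∫ w in Iic v, K w) atBot (𝓝 0) := by
  have h := ((aecover_Ioi (μ := volume) (tendsto_id (x := atBot (α := ℝ)))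
    ).integral_tendsto_of_countably_generated hi).const_sub (∫ w, K w)
  rw [sub_self] at h
  refine h.congr fun v => ?_
  have := integral_add_compl (measurableSet_Iic (a := v)) hi
  rw [compl_Iic] at this
  simp only [id]
  linarith

lemma integral_Iic_mem_Icc {K : ℝ → ℝ} (h0 : ∀ v, 0 ≤ K v) (hi : Integrable K)
    (h1 : ∫ v, K v = 1) (v : ℝ) : ∫ w in Iic v, K w ∈ Icc (0 : ℝ) 1 :=
  ⟨integral_nonneg h0, h1 ▸ setIntegral_le_integral hi (Eventually.of_forall h0)⟩

/-- Exchange of integration over the sublevel region of a measurable function. -/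
lemma integral_integral_indicator_swap {f k γ : ℝ → ℝ} (hf : Integrable f)
    (hk : Integrable k) (hγ : Measurable γ) :
    ∫ y, (∫ v in {v | y ≤ γ v}, k v) * f y = ∫ v, k v * ∫ y in Iic (γ v), f y := by
  have hs : MeasurableSet {p : ℝ × ℝ | p.1 ≤ γ p.2} :=
    measurableSet_le measurable_fst (hγ.comp measurable_snd)
  have hint : Integrable (Function.uncurry fun y v : ℝ =>
      ({p : ℝ × ℝ | p.1 ≤ γ p.2}.indicator fun p => f p.1 * k p.2) (y, v))
      (volume.prod volume) :=
    (hf.mul_prod hk).indicator hs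
  have hswap := integral_integral_swap hint
  calc ∫ y, (∫ v in {v | y ≤ γ v}, k v) * f y
      = ∫ y, ∫ v, ({p : ℝ × ℝ | p.1 ≤ γ p.2}.indicator fun p => f p.1 * k p.2) (y, v) := by
        refine integral_congr_ae (Eventually.of_forall fun y => ?_)
        simp only
        rw [← integral_indicator (measurableSet_le measurable_const hγ), mul_comm,
          ← integral_const_mul]
        refine integral_congr_ae (Eventually.of_forall fun v => ?_)
        by_cases h : y ≤ γ v <;> simp [indicator, h]
    _ = _ := hswap
    _ = _ := by
        refine integral_congr_ae (Eventually.of_forall fun v => ?_)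
        simp only
        rw [← integral_indicator measurableSet_Iic, ← integral_const_mul]
        refine integral_congr_ae (Eventually.of_forall fun y => ?_)
        by_cases h : y ≤ γ v <;> simp [indicator, h, mul_comm]

/-- As `h → 0⁺`,
`E[W²((g⁻¹(x) − g⁻¹(X))/h)] = F_X(x) − 2h·g'(g⁻¹(x))·f_X(x)·r₁ + o(h)`, where
`r₁ = ∫ v·K(v)·W(v) dv`. -/
theorem second_moment_boundary_free_kernel_df
    (Ωs : Set ℝ) (g ginv : ℝ → ℝ)
    (hg_mono : StrictMono g) (hg_range : Set.range g = Ωs)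
    (hg_diff : Differentiable ℝ g) (hg_diff2 : Differentiable ℝ (deriv g))
    (hginv_left : Function.LeftInverse ginv g)
    (hginv_right : ∀ x ∈ Ωs, g (ginv x) = x)
    (K : ℝ → ℝ) (hK_nonneg : ∀ v, 0 ≤ K v) (hK_cont : Continuous K)
    (hK_symm : ∀ v, K (-v) = K v)
    (hK_int : Integrable K) (hK_int1 : (∫ v, K v) = 1)
    (hK_mom2 : Integrable (fun v => v ^ 2 * K v))
    (W : ℝ → ℝ) (hW : ∀ v, W v = ∫ w in Set.Iic v, K w)
    (f : ℝ → ℝ) (hf_nonneg : ∀ y, 0 ≤ f y)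
    (hf_diff : Differentiable ℝ f) (hf_diff2 : Differentiable ℝ (deriv f))
    (hf_supp : ∀ y, y ∉ Ωs → f y = 0)
    (hf_int1 : (∫ y, f y) = 1)
    (F : ℝ → ℝ) (hF : ∀ x, F x = ∫ t in Set.Iic x, f t)
    (x : ℝ) (hx : x ∈ Ωs) :
    (fun h : ℝ => (∫ y, (W ((ginv x - ginv y) / h)) ^ 2 * f y) -
        (F x - 2 * h * deriv g (ginv x) * f x * ∫ v, v * K v * W v))
      =o[𝓝[>] 0] fun h => h := by
  have hf_int : Integrable f := by
    by_contra h
    rw [integral_undef h] at hf_int1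
    exact zero_ne_one hf_int1
  have hW_eq : W = fun v => ∫ w in Iic v, K w := funext hW
  have hF_eq : F = fun v => ∫ w in Iic v, f w := funext hF
  have hW_deriv : ∀ v, HasDerivAt W (K v) v := fun v => by
    rw [hW_eq]; exact hasDerivAt_integral_Iic hK_cont hK_int v
  have hF_deriv : ∀ v, HasDerivAt F (f v) v := fun v => by
    rw [hF_eq]; exact hasDerivAt_integral_Iic hf_diff.continuous hf_int v
  have hW_mem : ∀ v, W v ∈ Icc (0 : ℝ) 1 := fun v =>
    hW v ▸ integral_Iic_mem_Icc hK_nonneg hK_int hK_int1 v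
  have hF_mem : ∀ v, F v ∈ Icc (0 : ℝ) 1 := fun v =>
    hF v ▸ integral_Iic_mem_Icc hf_nonneg hf_int hf_int1 v
  have hW_cont : Continuous W := continuous_iff_continuousAt.2 fun v => (hW_deriv v).continuousAt
  have hF_cont : Continuous F := continuous_iff_continuousAt.2 fun v => (hF_deriv v).continuousAt
  have hg_cont : Continuous g := hg_diff.continuous
  -- the density of the distribution function `W ^ 2`
  set k : ℝ → ℝ := fun v => 2 * W v * K v with hk
  have hk_cont : Continuous k := by fun_prop
  have hk_nonneg : ∀ v, 0 ≤ k v := fun v =>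
    mul_nonneg (mul_nonneg zero_le_two (hW_mem v).1) (hK_nonneg v)
  have hk_le : ∀ v, k v ≤ 2 * K v := fun v =>
    mul_le_mul_of_nonneg_right (by linarith [(hW_mem v).2]) (hK_nonneg v)
  have hk_int : Integrable k :=
    (hK_int.const_mul 2).mono' hk_cont.aestronglyMeasurable
      (Eventually.of_forall fun v => by
        rw [Real.norm_eq_abs, abs_of_nonneg (hk_nonneg v)]; exact hk_le v)
  have hvk_int : Integrable fun v => v * k v := by
    refine ((hK_int.add hK_mom2).const_mul 2).mono'
      (Continuous.aestronglyMeasurable (by fun_prop)) (Eventually.of_forall fun v => ?_)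
    rw [Real.norm_eq_abs, abs_mul, abs_of_nonneg (hk_nonneg v)]
    have hv : |v| ≤ 1 + v ^ 2 := by nlinarith [sq_abs v, sq_nonneg (|v| - 1), abs_nonneg v]
    calc |v| * k v ≤ (1 + v ^ 2) * (2 * K v) :=
          mul_le_mul hv (hk_le v) (hk_nonneg v) (by positivity)
      _ = 2 * (K v + v ^ 2 * K v) := by ring
  have hW2_deriv : ∀ v, HasDerivAt (fun v => W v ^ 2) (k v) v := fun v => by
    have h := (hW_deriv v).fun_pow 2
    rwa [Nat.cast_ofNat, pow_one] at h
  have hW2_bot : Tendsto (fun v => W v ^ 2) atBot (𝓝 0) := by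
    have h := (tendsto_integral_Iic_atBot hK_int).pow 2
    simp only [← hW] at h
    simpa using h
  have hW2_top : Tendsto (fun v => W v ^ 2) atTop (𝓝 1) := by
    have h := (tendsto_integral_Iic_atTop hK_int).pow 2
    simp only [hK_int1, ← hW] at h
    simpa using h
  have hW2 : ∀ t, ∫ v in Iic t, k v = W t ^ 2 := fun t => by
    simpa using integral_Iic_of_hasDerivAt_of_tendsto' (fun v _ => hW2_deriv v)
      hk_int.integrableOn hW2_bot
  have hk_one : ∫ v, k v = 1 := by
    simpa using integral_of_hasDerivAt_of_tendsto hW2_deriv hk_int hW2_bot hW2_top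
  set a := ginv x with ha
  have hga : g a = x := hginv_right x hx
  have hG_deriv : HasDerivAt (fun u => F (g u)) (f x * deriv g a) a := by
    have := (hF_deriv (g a)).comp a (hg_diff a).hasDerivAt
    rwa [hga] at this
  have hG_cont : Continuous fun u => F (g u) := hF_cont.comp hg_cont
  have hG_bdd : ∀ u, |F (g u) - F (g a)| ≤ 1 := fun u => by
    have h₁ := hF_mem (g u)
    have h₂ := hF_mem (g a)
    exact abs_sub_le_iff.2 ⟨by linarith [h₁.2, h₂.1], by linarith [h₁.1, h₂.2]⟩
  have hexp : ∀ h : ℝ, 0 < h → ∫ y, (W ((a - ginv y) / h)) ^ 2 * f y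
      = ∫ v, k v * F (g (a - h * v)) := fun h hh => by
    simp only [hF]
    rw [← integral_integral_indicator_swap hf_int hk_int
      (γ := fun v => g (a - h * v)) (Continuous.measurable (by fun_prop))]
    refine integral_congr_ae (Eventually.of_forall fun y => ?_)
    by_cases hy : y ∈ Ωs
    · have hset : {v | y ≤ g (a - h * v)} = Iic ((a - ginv y) / h) := by
        ext v
        rw [mem_ofPred_eq, mem_Iic, le_div_iff₀ hh]
        conv_lhs => rw [← hginv_right y hy]
        rw [hg_mono.le_iff_le]
        constructor <;> intro hv <;> linarith
      simp only [hset, hW2]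
    · simp [hf_supp y hy]
  have hlim := tendsto_integral_mul_slope hG_deriv hG_cont hG_bdd hk_cont hvk_int
  have hkF_int : ∀ h, Integrable fun v => k v * F (g (a - h * v)) := fun h =>
    hk_int.mono' (Continuous.aestronglyMeasurable (by fun_prop))
      (Eventually.of_forall fun v => by
        have h₁ := hF_mem (g (a - h * v))
        rw [Real.norm_eq_abs, abs_of_nonneg (mul_nonneg (hk_nonneg v) h₁.1)]
        exact mul_le_of_le_one_right (hk_nonneg v) h₁.2)
  have hr : ∫ v, k v * (-v * (f x * deriv g a))
      = -(2 * deriv g a * f x * ∫ v, v * K v * W v) := by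
    rw [← integral_const_mul, ← integral_neg]
    refine integral_congr_ae (Eventually.of_forall fun v => ?_)
    simp only [hk]
    ring
  rw [hr] at hlim
  refine (isLittleO_iff_tendsto' ?_).2 ?_
  · filter_upwards [self_mem_nhdsWithin] with h (hh : 0 < h) h0
    exact absurd h0 hh.ne'
  · have hlim' := hlim.add_const (2 * deriv g a * f x * ∫ v, v * K v * W v)
    rw [neg_add_cancel] at hlim'
    refine hlim'.congr' ?_
    filter_upwards [self_mem_nhdsWithin] with h (hh : 0 < h)
    have hdiff : ∫ v, k v * ((F (g (a - h * v)) - F (g a)) / h)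
        = ((∫ v, k v * F (g (a - h * v))) - F x) / h := by
      have hsub := integral_sub (hkF_int h) (hk_int.mul_const (F x))
      rw [integral_mul_const, hk_one, one_mul] at hsub
      rw [← hsub, ← integral_div, hga]
      refine integral_congr_ae (Eventually.of_forall fun v => ?_)
      simp only
      ring
    rw [hdiff, hexp h hh]
    field_simp
    ring
end

section
/- If K : ℝ → ℝ is nonnegative, continuous, symmetric about 0, with ∫_ℝ K(v)dv = 1 and ∫_ℝ v²K(v)dv < ∞, and W(v) = ∫_{−∞}^v K(w)dw, then the constant r₁ = ∫_ℝ v·K(v)·W(v)dv is strictly positive. -/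
open MeasureTheory ProbabilityTheory Filter Topology Asymptotics Set

/-- For a nonnegative continuous kernel `K`, symmetric about `0`, with
`∫ K = 1` and finite second moment, the constant `r₁ = ∫ v·K(v)·W(v) dv` is strictly
positive, where `W(v) = ∫_{−∞}^v K`. -/
theorem r1_pos
    (K : ℝ → ℝ) (hK_nonneg : ∀ v, 0 ≤ K v) (hK_cont : Continuous K)
    (hK_symm : ∀ v, K (-v) = K v)
    (hK_int : Integrable K) (hK_int1 : (∫ v, K v) = 1)
    (hK_mom2 : Integrable (fun v => v ^ 2 * K v))
    (W : ℝ → ℝ) (hW : ∀ v, W v = ∫ w in Set.Iic v, K w) :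
    0 < ∫ v, v * K v * W v := by
  have hvK : Integrable (fun v => v * K v) := by
    refine (hK_int.add hK_mom2).mono' (by fun_prop) (ae_of_all _ fun v => ?_)
    rw [Real.norm_eq_abs, abs_mul, abs_of_nonneg (hK_nonneg v)]
    have h : |v| ≤ 1 + v ^ 2 := by nlinarith [sq_abs v, sq_nonneg (|v| - 1)]
    simpa [add_mul] using mul_le_mul_of_nonneg_right h (hK_nonneg v)
  have hodd : ∫ v, v * K v = 0 := by
    have h := integral_neg_eq_self (fun v => v * K v) volume
    simp only [hK_symm, neg_mul, integral_neg] at h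
    linarith
  -- By oddness of `v * K v`, we may replace `W v` by `W v - W 0 = ∫ w in 0..v, K w`.
  set P : ℝ → ℝ := fun v => ∫ w in (0 : ℝ)..v, K w with hP
  have hWP : ∀ v, W v = P v + W 0 := fun v => by
    simp only [hP, hW]
    rw [← intervalIntegral.integral_Iic_sub_Iic hK_int.integrableOn hK_int.integrableOn]
    ring
  have hPcont : Continuous P :=
    intervalIntegral.continuous_primitive (fun a b => hK_cont.intervalIntegrable a b) 0
  have hPbound : ∀ v, ‖P v‖ ≤ 1 := fun v => by
    refine (intervalIntegral.norm_integral_le_integral_norm_uIoc).trans ?_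
    rw [← hK_int1]
    simp only [Real.norm_eq_abs, abs_of_nonneg (hK_nonneg _)]
    exact setIntegral_le_integral hK_int (ae_of_all _ hK_nonneg)
  have hint : Integrable (fun v => v * K v * P v) :=
    hvK.mul_bdd hPcont.aestronglyMeasurable (ae_of_all _ hPbound)
  have heq : ∫ v, v * K v * W v = ∫ v, v * K v * P v := by
    have h : (fun v => v * K v * W v) = fun v => v * K v * P v + v * K v * W 0 :=
      funext fun v => by rw [hWP v, mul_add]
    rw [h, integral_add hint (hvK.mul_const _), integral_mul_const, hodd]
    simp
  have hnonneg : ∀ v, 0 ≤ v * K v * P v := fun v => by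
    rw [mul_right_comm]
    refine mul_nonneg ?_ (hK_nonneg v)
    rcases le_total 0 v with h | h
    · exact mul_nonneg h (intervalIntegral.integral_nonneg h fun w _ => hK_nonneg w)
    · refine mul_nonneg_of_nonpos_of_nonpos h ?_
      simp only [hP]
      rw [intervalIntegral.integral_symm, neg_nonpos]
      exact intervalIntegral.integral_nonneg h fun w _ => hK_nonneg w
  obtain ⟨v, hv, hKv⟩ : ∃ v, 0 < v ∧ 0 < K v := by
    by_contra! h
    have hzero : K =ᵐ[volume] 0 := by
      filter_upwards [Measure.ae_ne volume (0 : ℝ)] with v hv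
      refine le_antisymm ?_ (hK_nonneg v)
      rcases lt_or_gt_of_ne hv with h' | h'
      · simpa [hK_symm] using h (-v) (by linarith)
      · exact h v h'
    simp [integral_congr_ae hzero] at hK_int1
  have hPv : 0 < P v := intervalIntegral.integral_pos hv hK_cont.continuousOn
    (fun w _ => hK_nonneg w) ⟨v, right_mem_Icc.2 hv.le, hKv⟩
  rw [heq]
  exact integral_pos_of_integrable_nonneg_nonzero (x := v) (by fun_prop) hint hnonneg
    (by positivity)
end

section
/- For each fixed x ∈ Ω, as h → 0⁺, E[W((g⁻¹(x) − g⁻¹(X))/h)·1{X ≤ x}] = W(0)·F_X(x) + F_X(x)·∫_0^∞ K(v)dv + O(h) = F_X(x) + O(h). Consequently, with W₁*(x) = W((g⁻¹(x) − g⁻¹(X))/h) − F_X(x) and I₁*(x) = 1{X ≤ x} − F_X(x), one has E[W₁*(x)·I₁*(x)] = F_X(x)(1 − F_X(x)) + O(h). -/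
open MeasureTheory ProbabilityTheory Filter Topology Asymptotics Set

/-- A cumulative kernel with finite second moment approaches the Heaviside function
at a quadratic rate. -/
theorem exists_abs_cumulative_sub_heaviside_le (K : ℝ → ℝ) (hK_nonneg : ∀ v, 0 ≤ K v)
    (hK_int : Integrable K) (hK_int1 : (∫ v, K v) = 1)
    (hK_mom2 : Integrable (fun v => v ^ 2 * K v)) :
    ∃ C : ℝ, 0 ≤ C ∧ ∀ v,
      |(∫ w in Set.Iic v, K w) - (if 0 ≤ v then (1 : ℝ) else 0)| ≤ C * (1 + v ^ 2)⁻¹ := by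
  have hint : Integrable (fun w => (1 + w ^ 2) * K w) := by
    have := hK_int.add hK_mom2
    refine this.congr (Eventually.of_forall fun w => ?_)
    simp only [Pi.add_apply]
    ring
  have hnn : ∀ w, 0 ≤ (1 + w ^ 2) * K w := fun w => mul_nonneg (by positivity) (hK_nonneg w)
  have key : ∀ (s : Set ℝ) (v : ℝ), MeasurableSet s → (∀ w ∈ s, v ^ 2 ≤ w ^ 2) →
      (∫ w in s, K w) ≤ (∫ w, (1 + w ^ 2) * K w) * (1 + v ^ 2)⁻¹ := by
    intro s v hs hsv
    rw [← div_eq_mul_inv, le_div_iff₀ (by positivity), mul_comm, ← integral_const_mul]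
    calc (∫ w in s, (1 + v ^ 2) * K w) ≤ ∫ w in s, (1 + w ^ 2) * K w := by
          refine setIntegral_mono_on (hK_int.const_mul _).integrableOn hint.integrableOn hs ?_
          intro w hw
          have := hsv w hw
          exact mul_le_mul_of_nonneg_right (by linarith) (hK_nonneg w)
      _ ≤ _ := setIntegral_le_integral hint (Eventually.of_forall hnn)
  refine ⟨∫ w, (1 + w ^ 2) * K w, integral_nonneg hnn, fun v => ?_⟩
  split_ifs with hv
  · have hsplit := intervalIntegral.integral_Iic_add_Ioi (b := v) hK_int.integrableOn
      hK_int.integrableOn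
    have h0 : 0 ≤ ∫ w in Set.Ioi v, K w := integral_nonneg hK_nonneg
    have h1 := key (Set.Ioi v) v measurableSet_Ioi
      (fun w hw => pow_le_pow_left₀ hv (le_of_lt hw) 2)
    rw [show (∫ w in Set.Iic v, K w) - 1 = -∫ w in Set.Ioi v, K w by linarith, abs_neg,
      abs_of_nonneg h0]
    exact h1
  · have h0 : 0 ≤ ∫ w in Set.Iic v, K w := integral_nonneg hK_nonneg
    rw [sub_zero, abs_of_nonneg h0]
    refine key (Set.Iic v) v measurableSet_Iic fun w hw => ?_
    have : w ≤ v := hw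
    nlinarith

/-- If `ginv` inverts an increasing `C¹` map `g` onto its range, a rescaled quadratically decaying
function of `ginv x - ginv y` is dominated by a Cauchy profile in `y` plus a quadratic
remainder, against a continuous density vanishing off the range. -/
theorem exists_inv_one_add_sq_mul_density_le (g ginv : ℝ → ℝ) (hg_mono : StrictMono g)
    (hg_diff : Differentiable ℝ g) (hg_cont : Continuous (deriv g))
    (hginv : Function.LeftInverse ginv g) (f : ℝ → ℝ) (hf_nonneg : ∀ y, 0 ≤ f y)
    (hf_cont : Continuous f) (hf_supp : ∀ y, y ∉ Set.range g → f y = 0)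
    (x : ℝ) (hx : x ∈ Set.range g) :
    ∃ L M : ℝ, 0 < L ∧ 0 ≤ M ∧ ∀ h : ℝ, 0 < h → ∀ y,
      (1 + ((ginv x - ginv y) / h) ^ 2)⁻¹ * f y ≤
        h ^ 2 * f y + M * (1 + ((x - y) / (L * h)) ^ 2)⁻¹ := by
  obtain ⟨a, rfl⟩ := hx
  obtain ⟨L₀, hL₀⟩ := (isCompact_Icc (a := a - 1) (b := a + 1)).exists_bound_of_continuousOn
    hg_cont.continuousOn
  obtain ⟨M₀, hM₀⟩ := (isCompact_Icc (a := g (a - 1)) (b := g (a + 1))).exists_bound_of_continuousOn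
    hf_cont.continuousOn
  refine ⟨max L₀ 1, max M₀ 0, by positivity, by positivity, fun h hh y => ?_⟩
  set L := max L₀ 1
  set M := max M₀ 0
  have hL : 0 < L := by positivity
  have hM : 0 ≤ M := by positivity
  have hfy := hf_nonneg y
  by_cases hy : y ∈ Set.range g
  swap
  · rw [hf_supp y hy]
    simp only [mul_zero, zero_add]
    positivity
  obtain ⟨u, rfl⟩ := hy
  rw [hginv a, hginv u]
  by_cases hu : |a - u| ≤ 1
  · obtain ⟨h1, h2⟩ := abs_le.1 hu
    have huI : u ∈ Set.Icc (a - 1) (a + 1) := ⟨by linarith, by linarith⟩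
    have haI : a ∈ Set.Icc (a - 1) (a + 1) := ⟨by linarith, by linarith⟩
    have hlip := (convex_Icc (a - 1) (a + 1)).norm_image_sub_le_of_norm_deriv_le (𝕜 := ℝ)
      (f := g) (C := L) (fun z _ => hg_diff z) (fun z hz => (hL₀ z hz).trans (le_max_left _ _))
      huI haI
    rw [Real.norm_eq_abs, Real.norm_eq_abs] at hlip
    have hfM : f (g u) ≤ M := ((le_abs_self _).trans
      (hM₀ (g u) ⟨hg_mono.monotone huI.1, hg_mono.monotone huI.2⟩)).trans (le_max_left _ _)
    have hsq : ((g a - g u) / (L * h)) ^ 2 ≤ ((a - u) / h) ^ 2 := by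
      rw [sq_le_sq, abs_div, abs_div, abs_of_pos hh, abs_of_pos (mul_pos hL hh),
        div_le_div_iff₀ (mul_pos hL hh) hh]
      nlinarith
    calc (1 + ((a - u) / h) ^ 2)⁻¹ * f (g u)
        ≤ (1 + ((g a - g u) / (L * h)) ^ 2)⁻¹ * M :=
          mul_le_mul (inv_anti₀ (by positivity) (by linarith)) hfM hfy (by positivity)
      _ ≤ _ := by
          rw [mul_comm]
          exact le_add_of_nonneg_left (by positivity)
  · have hsq : 1 ≤ (a - u) ^ 2 := by
      rw [← sq_abs]
      nlinarith [not_le.1 hu]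
    have hle : (1 + ((a - u) / h) ^ 2)⁻¹ ≤ h ^ 2 := by
      rw [inv_le_comm₀ (by positivity) (by positivity), div_pow, ← one_div]
      have : 1 / h ^ 2 ≤ (a - u) ^ 2 / h ^ 2 := by gcongr
      linarith
    have := mul_le_mul_of_nonneg_right hle hfy
    exact this.trans (le_add_of_nonneg_right (by positivity))

/-- For fixed `x ∈ Ω`, as `h → 0⁺`,
`E[W((g⁻¹(x) − g⁻¹(X))/h)·1{X ≤ x}] = W(0)·F_X(x) + F_X(x)·∫_0^∞ K + O(h) = F_X(x) + O(h)`,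
and consequently `E[W₁*(x)·I₁*(x)] = F_X(x)(1 − F_X(x)) + O(h)`. -/
theorem cross_moment_expansion
    (Ωs : Set ℝ) (g ginv : ℝ → ℝ)
    (hg_mono : StrictMono g) (hg_range : Set.range g = Ωs)
    (hg_diff : Differentiable ℝ g) (hg_diff2 : Differentiable ℝ (deriv g))
    (hginv_left : Function.LeftInverse ginv g)
    (hginv_right : ∀ x ∈ Ωs, g (ginv x) = x)
    (K : ℝ → ℝ) (hK_nonneg : ∀ v, 0 ≤ K v) (hK_cont : Continuous K)
    (hK_symm : ∀ v, K (-v) = K v)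
    (hK_int : Integrable K) (hK_int1 : (∫ v, K v) = 1)
    (hK_mom2 : Integrable (fun v => v ^ 2 * K v))
    (W : ℝ → ℝ) (hW : ∀ v, W v = ∫ w in Set.Iic v, K w)
    (f : ℝ → ℝ) (hf_nonneg : ∀ y, 0 ≤ f y)
    (hf_diff : Differentiable ℝ f) (hf_diff2 : Differentiable ℝ (deriv f))
    (hf_supp : ∀ y, y ∉ Ωs → f y = 0)
    (hf_int1 : (∫ y, f y) = 1)
    (F : ℝ → ℝ) (hF : ∀ x, F x = ∫ t in Set.Iic x, f t)
    (x : ℝ) (hx : x ∈ Ωs) :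
    ((fun h : ℝ => (∫ y in Set.Iic x, W ((ginv x - ginv y) / h) * f y) -
        (W 0 * F x + F x * ∫ v in Set.Ioi (0 : ℝ), K v)) =O[𝓝[>] 0] fun h => h)
    ∧
    ((fun h : ℝ => (∫ y in Set.Iic x, W ((ginv x - ginv y) / h) * f y) - F x)
      =O[𝓝[>] 0] fun h => h)
    ∧
    ((fun h : ℝ =>
        (∫ y, (W ((ginv x - ginv y) / h) - F x) *
          ((if y ≤ x then (1 : ℝ) else 0) - F x) * f y)
          - F x * (1 - F x)) =O[𝓝[>] 0] fun h => h) := by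
  have hx' : x ∈ Set.range g := hg_range ▸ hx
  have hf_int : Integrable f := by
    by_contra hcon
    rw [integral_undef hcon] at hf_int1
    exact zero_ne_one hf_int1
  obtain ⟨C, hC0, hC⟩ :=
    exists_abs_cumulative_sub_heaviside_le K hK_nonneg hK_int hK_int1 hK_mom2
  obtain ⟨L, M, hL, hM, hLM⟩ := exists_inv_one_add_sq_mul_density_le g ginv hg_mono hg_diff
    hg_diff2.continuous hginv_left f hf_nonneg hf_diff.continuous
    (fun y hy => hf_supp y (hg_range ▸ hy)) x hx'
  have hW0 : ∀ v, 0 ≤ W v := fun v => hW v ▸ integral_nonneg hK_nonneg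
  have hW1 : ∀ v, W v ≤ 1 := fun v => by
    rw [hW v, ← hK_int1]
    exact setIntegral_le_integral hK_int (Eventually.of_forall hK_nonneg)
  have hW_mono : Monotone W := fun u v huv => by
    rw [hW u, hW v]
    exact setIntegral_mono_set hK_int.integrableOn (Eventually.of_forall hK_nonneg)
      (Set.Iic_subset_Iic.2 huv).eventuallyLE
  have hΩ : MeasurableSet Ωs := by
    rw [← hg_range]
    exact (isPreconnected_range hg_diff.continuous).ordConnected.measurableSet
  have hφ_int : ∀ h : ℝ, 0 < h → Integrable (fun y => W ((ginv x - ginv y) / h) * f y) := by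
    intro h hh
    have hanti : AntitoneOn (fun y => W ((ginv x - ginv y) / h)) Ωs := by
      intro y hy z hz hyz
      have : ginv y ≤ ginv z := by
        rw [← hg_mono.le_iff_le, hginv_right y hy, hginv_right z hz]
        exact hyz
      apply hW_mono
      gcongr
    have hmeas : AEMeasurable (fun y => W ((ginv x - ginv y) / h)) (volume.restrict Ωs) :=
      aemeasurable_restrict_of_antitoneOn hΩ hanti
    have hon : IntegrableOn (fun y => W ((ginv x - ginv y) / h) * f y) Ωs := by
      refine hf_int.integrableOn.bdd_mul (c := 1) hmeas.aestronglyMeasurable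
        (Eventually.of_forall fun y => ?_)
      rw [Real.norm_eq_abs, abs_of_nonneg (hW0 _)]
      exact hW1 _
    rw [← integrable_indicator_iff hΩ] at hon
    refine hon.congr (Eventually.of_forall fun y => ?_)
    by_cases hy : y ∈ Ωs
    · simp [hy]
    · simp [hy, hf_supp y hy]
  have hpoint : ∀ h : ℝ, 0 < h → ∀ y,
      ‖W ((ginv x - ginv y) / h) * f y - (Set.Iic x).indicator f y‖ ≤
        C * (h ^ 2 * f y + M * (1 + ((x - y) / (L * h)) ^ 2)⁻¹) := by
    intro h hh y
    have hb := hLM h hh y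
    by_cases hy : y ∈ Ωs
    · have hiff : 0 ≤ (ginv x - ginv y) / h ↔ y ≤ x := by
        rw [le_div_iff₀ hh, zero_mul, sub_nonneg, ← hg_mono.le_iff_le, hginv_right y hy,
          hginv_right x hx]
      have heq : W ((ginv x - ginv y) / h) * f y - (Set.Iic x).indicator f y =
          ((∫ w in Set.Iic ((ginv x - ginv y) / h), K w) -
            if 0 ≤ (ginv x - ginv y) / h then 1 else 0) * f y := by
        rw [← hW, Set.indicator_apply]
        simp only [hiff, Set.mem_Iic]
        split_ifs <;> ring
      rw [heq, norm_mul, Real.norm_eq_abs, Real.norm_eq_abs, abs_of_nonneg (hf_nonneg y)]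
      calc _ ≤ (C * (1 + ((ginv x - ginv y) / h) ^ 2)⁻¹) * f y :=
            mul_le_mul_of_nonneg_right (hC _) (hf_nonneg y)
        _ = C * ((1 + ((ginv x - ginv y) / h) ^ 2)⁻¹ * f y) := by ring
        _ ≤ _ := mul_le_mul_of_nonneg_left hb hC0
    · have hf0 := hf_supp y hy
      simp only [Set.indicator_apply, hf0, ite_self, mul_zero, sub_zero, norm_zero, zero_add]
      positivity
  have hcauchy : ∀ h : ℝ, 0 < h →
      Integrable (fun y => (1 + ((x - y) / (L * h)) ^ 2)⁻¹) ∧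
      (∫ y, (1 + ((x - y) / (L * h)) ^ 2)⁻¹) = L * h * Real.pi := by
    intro h hh
    have hLh : 0 < L * h := mul_pos hL hh
    constructor
    · exact (integrable_inv_one_add_sq.comp_div hLh.ne').comp_sub_left x
    · rw [integral_sub_left_eq_self (fun z : ℝ => (1 + (z / (L * h)) ^ 2)⁻¹) volume x,
        Measure.integral_comp_div (fun z : ℝ => (1 + z ^ 2)⁻¹) (L * h),
        integral_univ_inv_one_add_sq, abs_of_pos hLh, smul_eq_mul]
  have hind_int : Integrable ((Set.Iic x).indicator f) := hf_int.indicator measurableSet_Iic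
  have hL1 : ∀ h : ℝ, 0 < h → h ≤ 1 →
      (∫ y, ‖W ((ginv x - ginv y) / h) * f y - (Set.Iic x).indicator f y‖) ≤
        C * (1 + M * (L * Real.pi)) * h := by
    intro h hh hh1
    obtain ⟨hci, hcv⟩ := hcauchy h hh
    calc _ ≤ ∫ y, C * (h ^ 2 * f y + M * (1 + ((x - y) / (L * h)) ^ 2)⁻¹) :=
          integral_mono ((hφ_int h hh).sub hind_int).norm
            (((hf_int.const_mul _).add (hci.const_mul _)).const_mul _) (hpoint h hh)
      _ = C * (h ^ 2 + M * (L * h * Real.pi)) := by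
          rw [integral_const_mul, integral_add (hf_int.const_mul _) (hci.const_mul _),
            integral_const_mul, integral_const_mul, hcv, hf_int1, mul_one]
      _ ≤ C * (h + M * (L * h * Real.pi)) := by
          gcongr
          nlinarith
      _ = _ := by ring
  have hFind : (∫ y, (Set.Iic x).indicator f y) = F x := by
    rw [integral_indicator measurableSet_Iic, hF]
  have hpos : ∀ᶠ h : ℝ in 𝓝[>] 0, 0 < h ∧ h ≤ 1 := by
    filter_upwards [Ioc_mem_nhdsGT (zero_lt_one' ℝ)] with h hh using hh
  have hA : (fun h : ℝ => (∫ y in Set.Iic x, W ((ginv x - ginv y) / h) * f y) - F x)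
      =O[𝓝[>] 0] fun h => h := by
    refine IsBigO.of_bound (C * (1 + M * (L * Real.pi))) ?_
    filter_upwards [hpos] with h ⟨hh, hh1⟩
    rw [Real.norm_of_nonneg hh.le]
    have heq : (∫ y in Set.Iic x, W ((ginv x - ginv y) / h) * f y) - F x =
        ∫ y in Set.Iic x, (W ((ginv x - ginv y) / h) * f y - (Set.Iic x).indicator f y) := by
      rw [integral_sub (hφ_int h hh).integrableOn hind_int.integrableOn, hF,
        setIntegral_indicator measurableSet_Iic, Set.inter_self]
    rw [heq]
    exact ((norm_integral_le_integral_norm _).trans (setIntegral_le_integral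
      ((hφ_int h hh).sub hind_int).norm (Eventually.of_forall fun _ => norm_nonneg _))).trans
      (hL1 h hh hh1)
  have hB : (fun h : ℝ => (∫ y, W ((ginv x - ginv y) / h) * f y) - F x)
      =O[𝓝[>] 0] fun h => h := by
    refine IsBigO.of_bound (C * (1 + M * (L * Real.pi))) ?_
    filter_upwards [hpos] with h ⟨hh, hh1⟩
    rw [Real.norm_of_nonneg hh.le, ← hFind, ← integral_sub (hφ_int h hh) hind_int]
    exact (norm_integral_le_integral_norm _).trans (hL1 h hh hh1)
  have hsum : W 0 * F x + F x * ∫ v in Set.Ioi (0 : ℝ), K v = F x := by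
    have := intervalIntegral.integral_Iic_add_Ioi (b := (0 : ℝ)) hK_int.integrableOn
      hK_int.integrableOn
    rw [hK_int1, ← hW] at this
    linear_combination F x * this
  refine ⟨by simpa only [hsum] using hA, hA, ?_⟩
  refine (hA.sub (hB.const_mul_left (F x))).congr' ?_ EventuallyEq.rfl
  filter_upwards [hpos] with h ⟨hh, hh1⟩
  have hφ := hφ_int h hh
  have hφi := hφ.indicator (measurableSet_Iic (a := x))
  have heq : (∫ y, (W ((ginv x - ginv y) / h) - F x) *
        ((if y ≤ x then (1 : ℝ) else 0) - F x) * f y) =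
      ∫ y, (((Set.Iic x).indicator (fun y => W ((ginv x - ginv y) / h) * f y) y -
        F x * (W ((ginv x - ginv y) / h) * f y)) -
        (F x * (Set.Iic x).indicator f y - F x ^ 2 * f y)) := by
    congr 1 with y
    simp only [Set.indicator_apply, Set.mem_Iic]
    split_ifs <;> ring
  have hleft : Integrable (fun y =>
      (Set.Iic x).indicator (fun y => W ((ginv x - ginv y) / h) * f y) y -
        F x * (W ((ginv x - ginv y) / h) * f y)) := hφi.sub (hφ.const_mul _)
  have hright : Integrable (fun y => F x * (Set.Iic x).indicator f y - F x ^ 2 * f y) :=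
    (hind_int.const_mul _).sub (hf_int.const_mul _)
  rw [heq, integral_sub hleft hright,
    integral_sub hφi (hφ.const_mul _), integral_sub (hind_int.const_mul _) (hf_int.const_mul _),
    integral_const_mul, integral_const_mul, integral_const_mul, hFind, hf_int1,
    integral_indicator measurableSet_Iic]
  ring
end
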